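/- arXiv:math/9903170 — 2 statements merged into one kernel-verified Lean document; each statement's English description precedes it below -/
import Mathlib

section
/- Let A₃(n) denote the number of permutations of length n containing no 132 pattern and exactly three 123 patterns. Then in ℚ[[z]], the generating function F₃(z) = ∑_{n≥0} A₃(n)·zⁿ satisfies (1 - 2z)⁴·F₃(z) = z⁵·(z - 1)². -/
/-- The number of 132 patterns of a permutation `π` of `Fin n`:
triples of indices `i₁ < i₂ < i₃` with `π i₁ < π i₃ < π i₂`. -/
def count132 {n : ℕ} (π : Equiv.Perm (Fin n)) : ℕ :=
  (Finset.univ.filter (fun p : Fin n × Fin n × Fin n =>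
    p.1 < p.2.1 ∧ p.2.1 < p.2.2 ∧ π p.1 < π p.2.2 ∧ π p.2.2 < π p.2.1)).card

/-- The number of 123 patterns of a permutation `π` of `Fin n`:
triples of indices `i₁ < i₂ < i₃` with `π i₁ < π i₂ < π i₃`. -/
def count123 {n : ℕ} (π : Equiv.Perm (Fin n)) : ℕ :=
  (Finset.univ.filter (fun p : Fin n × Fin n × Fin n =>
    p.1 < p.2.1 ∧ p.2.1 < p.2.2 ∧ π p.1 < π p.2.1 ∧ π p.2.1 < π p.2.2)).card

/-- The number of 12 patterns of a permutation `π` of `Fin n`: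
pairs of indices `i₁ < i₂` with `π i₁ < π i₂`. -/
def count12 {n : ℕ} (π : Equiv.Perm (Fin n)) : ℕ :=
  (Finset.univ.filter (fun p : Fin n × Fin n =>
    p.1 < p.2 ∧ π p.1 < π p.2)).card

/-- The number of permutations of length n with no 132 pattern and exactly 3 123 patterns. -/
def A (n : ℕ) : ℕ :=
  (Finset.univ.filter (fun π : Equiv.Perm (Fin n) =>
    count132 π = 0 ∧ count123 π = 3)).card


open BinaryTree

/-! ### Generic counts on lists -/

/-- Number of pairs of positions in a list satisfying a relation. -/
def cnt2 (r : ℕ → ℕ → Bool) : List ℕ → ℕ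
  | [] => 0
  | a :: l => l.countP (r a) + cnt2 r l

/-- Number of triples of positions in a list satisfying a relation. -/
def cnt3 (r : ℕ → ℕ → ℕ → Bool) : List ℕ → ℕ
  | [] => 0
  | a :: l => cnt2 (r a) l + cnt3 r l

def r12 (a b : ℕ) : Bool := decide (a < b)
def r123 (a b c : ℕ) : Bool := decide (a < b ∧ b < c)
def r132 (a b c : ℕ) : Bool := decide (a < c ∧ c < b)

theorem sum_countP {n : ℕ} (f : Fin n → ℕ) (p : ℕ → Bool) :
    (∑ i, if p (f i) = true then 1 else 0) = (List.ofFn f).countP p := by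
  induction n with
  | zero => simp
  | succ n ih =>
    rw [Fin.sum_univ_succ, List.ofFn_succ, List.countP_cons, ← ih, add_comm]

theorem sum_cnt2 {n : ℕ} (f : Fin n → ℕ) (r : ℕ → ℕ → Bool) :
    (∑ i, ∑ j, if i < j ∧ r (f i) (f j) = true then 1 else 0) = cnt2 r (List.ofFn f) := by
  induction n with
  | zero => simp [cnt2]
  | succ n ih =>
    rw [Fin.sum_univ_succ, List.ofFn_succ, cnt2, ← ih, ← sum_countP]
    simp only [Fin.sum_univ_succ, Fin.succ_lt_succ_iff, Fin.succ_pos, Fin.not_lt_zero, lt_self_iff_false,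
      true_and, false_and, and_false, if_false, Finset.sum_const_zero, zero_add, add_zero]

theorem sum_cnt3 {n : ℕ} (f : Fin n → ℕ) (r : ℕ → ℕ → ℕ → Bool) :
    (∑ i, ∑ j, ∑ k, if i < j ∧ j < k ∧ r (f i) (f j) (f k) = true then 1 else 0)
      = cnt3 r (List.ofFn f) := by
  induction n with
  | zero => simp [cnt3]
  | succ n ih =>
    rw [Fin.sum_univ_succ, List.ofFn_succ, cnt3, ← ih, ← sum_cnt2]
    simp only [Fin.sum_univ_succ, Fin.succ_lt_succ_iff, Fin.succ_pos, Fin.not_lt_zero, lt_self_iff_false,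
      true_and, false_and, and_false, if_false, Finset.sum_const_zero, zero_add, add_zero]

/-- The one-line notation of a permutation. -/
def permList {n : ℕ} (π : Equiv.Perm (Fin n)) : List ℕ := List.ofFn (fun i => (π i : ℕ))

theorem count123_eq {n : ℕ} (π : Equiv.Perm (Fin n)) : count123 π = cnt3 r123 (permList π) := by
  rw [permList, ← sum_cnt3, count123, Finset.card_filter, Fintype.sum_prod_type]
  simp only [Fintype.sum_prod_type, r123, decide_eq_true_eq, Fin.lt_def]

theorem count132_eq {n : ℕ} (π : Equiv.Perm (Fin n)) : count132 π = cnt3 r132 (permList π) := by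
  rw [permList, ← sum_cnt3, count132, Finset.card_filter, Fintype.sum_prod_type]
  simp only [Fintype.sum_prod_type, r132, decide_eq_true_eq, Fin.lt_def]

theorem permList_injective {n : ℕ} : Function.Injective (permList (n := n)) := by
  intro π σ h
  have := List.ofFn_injective h
  ext i
  exact congrFun this i

theorem permList_perm {n : ℕ} (π : Equiv.Perm (Fin n)) : (permList π).Perm (List.range n) := by
  rw [List.perm_ext_iff_of_nodup _ List.nodup_range]
  · intro a
    simp only [permList, List.mem_ofFn, List.mem_range]
    constructor
    · rintro ⟨i, rfl⟩; exact (π i).2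
    · intro h; exact ⟨π.symm ⟨a, h⟩, by simp⟩
  · rw [permList, List.nodup_ofFn]
    exact Fin.val_injective.comp π.injective

theorem exists_permList {n : ℕ} (l : List ℕ) (h : l.Perm (List.range n)) :
    ∃ π : Equiv.Perm (Fin n), permList π = l := by
  have hl : l.length = n := by simpa using h.length_eq
  have hn : l.Nodup := h.nodup_iff.2 List.nodup_range
  subst hl
  have hm : ∀ i : Fin l.length, l.get i < l.length := fun i => by
    have := h.mem_iff.1 (List.get_mem l i)
    simpa using this
  have hinj : Function.Injective (fun i : Fin l.length => (⟨l.get i, hm i⟩ : Fin l.length)) := by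
    intro i j hij
    exact List.nodup_iff_injective_get.1 hn (by simpa using hij)
  refine ⟨Equiv.ofBijective _ (Finite.injective_iff_bijective.1 hinj), ?_⟩
  simp [permList]

/-! ### Counts of decomposed lists -/

theorem countP_sub (p : ℕ → Bool) {l l' : List ℕ} (h : l.Sublist l') :
    l.countP p ≤ l'.countP p := h.countP_le

theorem cnt2_sub (r : ℕ → ℕ → Bool) {l l' : List ℕ} (h : l.Sublist l') :
    cnt2 r l ≤ cnt2 r l' := by
  induction h with
  | slnil => simp
  | cons a h ih => simp only [cnt2]; omega
  | cons_cons a h ih => simp only [cnt2]; have := countP_sub (r a) h; omega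

theorem cnt3_sub (r : ℕ → ℕ → ℕ → Bool) {l l' : List ℕ} (h : l.Sublist l') :
    cnt3 r l ≤ cnt3 r l' := by
  induction h with
  | slnil => simp
  | cons a h ih => simp only [cnt3]; omega
  | cons_cons a h ih => simp only [cnt3]; have := cnt2_sub (r a) h; omega

theorem cnt2_zero (r : ℕ → ℕ → Bool) (l : List ℕ) (h : ∀ a ∈ l, ∀ b ∈ l, r a b = false) :
    cnt2 r l = 0 := by
  induction l with
  | nil => rfl
  | cons a l ih =>
    rw [cnt2, ih (fun x hx y hy => h x (by simp [hx]) y (by simp [hy]))]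
    rw [List.countP_eq_zero.2]
    intro b hb
    simp [h a (by simp) b (by simp [hb])]

theorem cnt2_12_split (L R : List ℕ) (N : ℕ) (h1 : ∀ a ∈ L, ∀ b ∈ R, b < a)
    (h2 : ∀ a ∈ L, a < N) (h3 : ∀ b ∈ R, b < N) :
    cnt2 r12 (L ++ N :: R) = cnt2 r12 L + cnt2 r12 R + L.length := by
  induction L with
  | nil =>
    simp only [List.nil_append, cnt2, List.length_nil]
    rw [List.countP_eq_zero.2]
    · omega
    · intro b hb; have := h3 b hb; simp [r12]; omega
  | cons a L ih =>
    rw [List.cons_append, cnt2, ih (fun x hx => h1 x (by simp [hx])) (fun x hx => h2 x (by simp [hx])),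
      cnt2, List.countP_append, List.countP_cons, (List.countP_eq_zero (l := R)).2]
    · have := h2 a (by simp)
      simp [r12, this]; omega
    · intro b hb; have := h1 a (by simp) b hb; simp [r12]; omega

theorem cnt2_123_split (L R : List ℕ) (N a : ℕ) (h1 : ∀ b ∈ R, b < a)
    (h2 : ∀ b ∈ L, b < N) :
    cnt2 (r123 a) (L ++ N :: R) = cnt2 (r123 a) L + L.countP (r12 a) := by
  induction L with
  | nil =>
    simp only [List.nil_append, cnt2, List.countP_nil]
    rw [cnt2_zero, List.countP_eq_zero.2]
    · intro b hb; have := h1 b hb; simp [r123]; omega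
    · intro b hb c hc; have := h1 b hb; simp [r123]; omega
  | cons b L ih =>
    rw [List.cons_append, cnt2, ih (fun x hx => h2 x (by simp [hx])),
      cnt2, List.countP_append, List.countP_cons, List.countP_cons, (List.countP_eq_zero (l := R)).2]
    · have := h2 b (by simp)
      simp [r123, r12, this]; omega
    · intro c hc; have := h1 c hc; simp [r123]; omega

theorem cnt3_123_split (L R : List ℕ) (N : ℕ) (h1 : ∀ a ∈ L, ∀ b ∈ R, b < a)
    (h2 : ∀ a ∈ L, a < N) (h3 : ∀ b ∈ R, b < N) :
    cnt3 r123 (L ++ N :: R) = cnt3 r123 L + cnt2 r12 L + cnt3 r123 R := by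
  induction L with
  | nil =>
    simp only [List.nil_append, cnt3, cnt2]
    rw [cnt2_zero]
    · intro b hb c hc; have := h3 b hb; simp [r123]; omega
  | cons a L ih =>
    rw [List.cons_append, cnt3, ih (fun x hx => h1 x (by simp [hx])) (fun x hx => h2 x (by simp [hx])),
      cnt2_123_split L R N a (h1 a (by simp)) (fun x hx => h2 x (by simp [hx])), cnt3, cnt2]
    omega

theorem cnt2_132_split (L R : List ℕ) (N a : ℕ) (h1 : ∀ b ∈ R, b < a)
    (h2 : ∀ b ∈ L, b < N) :
    cnt2 (r132 a) (L ++ N :: R) = cnt2 (r132 a) L := by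
  induction L with
  | nil =>
    simp only [List.nil_append, cnt2]
    rw [cnt2_zero, List.countP_eq_zero.2]
    · intro b hb; have := h1 b hb; simp [r132]; omega
    · intro b hb c hc; have := h1 c hc; simp [r132]; omega
  | cons b L ih =>
    rw [List.cons_append, cnt2, ih (fun x hx => h2 x (by simp [hx])),
      cnt2, List.countP_append, List.countP_cons, (List.countP_eq_zero (l := R)).2]
    · have := h2 b (by simp)
      simp [r132]; omega
    · intro c hc; have := h1 c hc; simp [r132]; omega

theorem cnt3_132_split (L R : List ℕ) (N : ℕ) (h1 : ∀ a ∈ L, ∀ b ∈ R, b < a)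
    (h2 : ∀ a ∈ L, a < N) (h3 : ∀ b ∈ R, b < N) :
    cnt3 r132 (L ++ N :: R) = cnt3 r132 L + cnt3 r132 R := by
  induction L with
  | nil =>
    simp only [List.nil_append, cnt3]
    rw [cnt2_zero]
    · intro b hb c hc; have := h3 c hc; simp [r132]; omega
  | cons a L ih =>
    rw [List.cons_append, cnt3, ih (fun x hx => h1 x (by simp [hx])) (fun x hx => h2 x (by simp [hx])),
      cnt2_132_split L R N a (h1 a (by simp)) (fun x hx => h2 x (by simp [hx])), cnt3]
    omega

theorem cnt2_map (r r' : ℕ → ℕ → Bool) (g : ℕ → ℕ) (h : ∀ a b, r (g a) (g b) = r' a b)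
    (l : List ℕ) : cnt2 r (l.map g) = cnt2 r' l := by
  induction l with
  | nil => rfl
  | cons a l ih =>
    rw [List.map_cons, cnt2, cnt2, ih, List.countP_map]
    congr 2
    funext b; exact h a b

theorem cnt3_map (r r' : ℕ → ℕ → ℕ → Bool) (g : ℕ → ℕ)
    (h : ∀ a b c, r (g a) (g b) (g c) = r' a b c)
    (l : List ℕ) : cnt3 r (l.map g) = cnt3 r' l := by
  induction l with
  | nil => rfl
  | cons a l ih =>
    rw [List.map_cons, cnt3, cnt3, ih, cnt2_map _ _ g (h a)]

/-! ### Trees and 132-avoiding lists -/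

def toL : BinaryTree Unit → List ℕ
  | .nil => []
  | .node _ L R => (toL L).map (· + R.numNodes) ++ (L.numNodes + R.numNodes) :: toL R

def s12 : BinaryTree Unit → ℕ
  | .nil => 0
  | .node _ L R => s12 L + s12 R + L.numNodes

def s123 : BinaryTree Unit → ℕ
  | .nil => 0
  | .node _ L R => s123 L + s12 L + s123 R

theorem toL_perm (t : BinaryTree Unit) : (toL t).Perm (List.range t.numNodes) := by
  induction t with
  | nil => simp [toL, numNodes]
  | node _ L R ihL ihR =>
    simp only [toL, numNodes]
    have h1 : ((toL L).map (· + R.numNodes)).Perm ((List.range L.numNodes).map (· + R.numNodes)) :=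
      ihL.map _
    rw [List.range_succ, add_comm L.numNodes, List.range_add]
    have : (List.range L.numNodes).map (· + R.numNodes) =
      (List.range L.numNodes).map (R.numNodes + ·) := by
      simp [add_comm]
    rw [← this]
    refine List.perm_middle.trans ?_
    refine List.Perm.trans ?_ (List.perm_append_singleton _ _).symm
    refine List.Perm.cons _ ?_
    exact (h1.append ihR).trans List.perm_append_comm

theorem toL_lt {t : BinaryTree Unit} {a : ℕ} (h : a ∈ toL t) : a < t.numNodes := by
  simpa using (toL_perm t).mem_iff.1 h

theorem toL_length (t : BinaryTree Unit) : (toL t).length = t.numNodes := by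
  simpa using (toL_perm t).length_eq

theorem toL_stats (t : BinaryTree Unit) :
    cnt2 r12 (toL t) = s12 t ∧ cnt3 r123 (toL t) = s123 t ∧ cnt3 r132 (toL t) = 0 := by
  induction t with
  | nil => simp [toL, cnt2, cnt3, s12, s123]
  | node _ L R ihL ihR =>
    have h1 : ∀ a ∈ (toL L).map (· + R.numNodes), ∀ b ∈ toL R, b < a := by
      intro a ha b hb
      obtain ⟨c, hc, rfl⟩ := List.mem_map.1 ha
      have := toL_lt hb
      omega
    have h2 : ∀ a ∈ (toL L).map (· + R.numNodes), a < L.numNodes + R.numNodes := by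
      intro a ha
      obtain ⟨c, hc, rfl⟩ := List.mem_map.1 ha
      have := toL_lt hc
      omega
    have h3 : ∀ b ∈ toL R, b < L.numNodes + R.numNodes := by
      intro b hb
      have := toL_lt hb
      omega
    simp only [toL, s12, s123]
    rw [cnt2_12_split _ _ _ h1 h2 h3, cnt3_123_split _ _ _ h1 h2 h3, cnt3_132_split _ _ _ h1 h2 h3,
      cnt2_map r12 r12 _ (by simp [r12]), cnt3_map r123 r123 _ (by simp [r123]),
      cnt3_map r132 r132 _ (by simp [r132]), List.length_map, toL_length,
      ihL.1, ihL.2.1, ihL.2.2, ihR.1, ihR.2.1, ihR.2.2]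
    simp

theorem split_unique {L R L' R' : List ℕ} {N : ℕ} (h : L ++ N :: R = L' ++ N :: R')
    (hL : N ∉ L) (hL' : N ∉ L') : L = L' ∧ R = R' := by
  induction L generalizing L' with
  | nil =>
    cases L' with
    | nil => simpa using h
    | cons a L' => simp at h; simp [h.1] at hL'
  | cons a L ih =>
    cases L' with
    | nil => simp at h; simp [h.1] at hL
    | cons b L' =>
      simp only [List.cons_append, List.cons.injEq] at h
      have := ih h.2 (by simp at hL; tauto) (by simp at hL'; tauto)
      exact ⟨by rw [h.1, this.1], this.2⟩

theorem toL_injective : Function.Injective toL := by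
  intro t
  induction t with
  | nil =>
    intro t' h
    cases t' with
    | nil => rfl
    | node _ L R => simp [toL] at h
  | node _ L R ihL ihR =>
    intro t' h
    cases t' with
    | nil => simp [toL] at h
    | node _ L' R' =>
      have hlen := congrArg List.length h
      rw [toL_length, toL_length, numNodes, numNodes] at hlen
      have hN : L.numNodes + R.numNodes = L'.numNodes + R'.numNodes := by omega
      simp only [toL] at h
      rw [hN] at h
      obtain ⟨h1, h2⟩ := split_unique h
        (by intro hm
            obtain ⟨c, hc, h⟩ := List.mem_map.1 hm
            have := toL_lt hc
            omega)
        (by intro hm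
            obtain ⟨c, hc, h⟩ := List.mem_map.1 hm
            have := toL_lt hc
            omega)
      have hR := ihR h2
      subst hR
      have := ihL (List.map_injective_iff.2 (add_left_injective _) h1)
      subst this
      rfl

/-- A nodup initial/final segment decomposition. -/
theorem split_perm {k m : ℕ} {L R : List ℕ} (hk : L.length = k) (hm : R.length = m)
    (h : (L ++ R).Perm (List.range (k + m))) (h1 : ∀ a ∈ L, ∀ b ∈ R, b < a) :
    (∀ a ∈ L, m ≤ a) ∧ R.Perm (List.range m) ∧ (L.map (· - m)).Perm (List.range k) := by
  have hnd : (L ++ R).Nodup := h.nodup_iff.2 List.nodup_range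
  have hndL := (List.nodup_append.1 hnd).1
  have hndR := (List.nodup_append.1 hnd).2.1
  have hmem : ∀ a, a ∈ L ∨ a ∈ R ↔ a < k + m := by
    intro a; simpa using h.mem_iff (a := a)
  have hLm : ∀ a ∈ L, m ≤ a := by
    intro a ha
    have hsub : R.toFinset ⊆ Finset.range a := by
      intro b hb
      simpa using h1 a ha b (by simpa using hb)
    have := Finset.card_le_card hsub
    rw [List.toFinset_card_of_nodup hndR] at this
    simpa [hm] using this
  have hRm : ∀ b ∈ R, b < m := by
    intro b hb
    by_contra hbm
    have hsub : L.toFinset ⊆ Finset.Ioo b (k + m) := by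
      intro a ha
      have ha : a ∈ L := by simpa using ha
      simpa using ⟨h1 a ha b hb, (hmem a).1 (Or.inl ha)⟩
    have := Finset.card_le_card hsub
    rw [List.toFinset_card_of_nodup hndL] at this
    have hb2 := (hmem b).1 (Or.inr hb)
    simp at this
    omega
  refine ⟨hLm, ?_, ?_⟩
  · rw [List.perm_ext_iff_of_nodup hndR List.nodup_range]
    intro a
    rw [List.mem_range]
    refine ⟨hRm a, fun ha => ?_⟩
    rcases (hmem a).2 (by omega) with h | h
    · have := hLm a h; omega
    · exact h
  · rw [List.perm_ext_iff_of_nodup _ List.nodup_range]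
    · intro a
      rw [List.mem_range, List.mem_map]
      constructor
      · rintro ⟨c, hc, rfl⟩
        have := hLm c hc
        have := (hmem c).1 (Or.inl hc)
        omega
      · intro ha
        refine ⟨a + m, ?_, by omega⟩
        rcases (hmem (a + m)).2 (by omega) with h | h
        · exact h
        · have := hRm _ h; omega
    · refine List.Nodup.map_on ?_ hndL
      intro x hx y hy hxy
      have := hLm x hx
      have := hLm y hy
      omega

theorem exists_toL (n : ℕ) : ∀ l : List ℕ, l.Perm (List.range n) → cnt3 r132 l = 0 →
    ∃ t : BinaryTree Unit, t.numNodes = n ∧ toL t = l := by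
  induction n using Nat.strong_induction_on with
  | _ n ih =>
    intro l hl h0
    rcases n with _ | n
    · refine ⟨.nil, rfl, ?_⟩
      simp at hl; simp [toL, hl]
    · have hn : n ∈ l := hl.mem_iff.2 (by simp)
      obtain ⟨L, R, rfl⟩ := List.append_of_mem hn
      have hlt : ∀ a ∈ L ++ R, a < n := by
        intro a ha
        have hnd : (L ++ n :: R).Nodup := hl.nodup_iff.2 List.nodup_range
        have hnd2 := (List.perm_middle.nodup_iff.1 hnd)
        have h1 : a < n + 1 := by
          have := hl.mem_iff.1 (List.perm_middle.mem_iff.2 (List.mem_cons_of_mem n ha))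
          simpa using this
        have h2 : a ≠ n := by
          rintro rfl
          exact (List.nodup_cons.1 hnd2).1 ha
        omega
      have hLR : (L ++ R).Perm (List.range n) := by
        have h1 := List.perm_middle.symm.trans hl
        rw [List.range_succ] at h1
        exact (h1.trans (List.perm_append_singleton _ _)).cons_inv
      have h1 : ∀ a ∈ L, ∀ b ∈ R, b < a := by
        intro a ha b hb
        have hne : a ≠ b := by
          have hnd : (L ++ R).Nodup := hLR.nodup_iff.2 List.nodup_range
          exact (List.nodup_append.1 hnd).2.2 a ha b hb
        by_contra hab
        have hs : [a, n, b].Sublist (L ++ n :: R) := by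
          have : [a, n, b] = [a] ++ n :: [b] := rfl
          rw [this]
          exact (List.singleton_sublist.2 ha).append ((List.singleton_sublist.2 hb).cons_cons n)
        have := cnt3_sub r132 hs
        have hbn := hlt b (by simp [hb])
        have hab' : a < b := by omega
        simp [cnt3, cnt2, r132, hab', hbn] at this
        omega
      have hlen : L.length + R.length = n := by simpa using hLR.length_eq
      obtain ⟨hLm, hR, hL⟩ := split_perm (k := L.length) (m := R.length) rfl rfl
        (by rw [hlen]; exact hLR) h1
      have hsplit := cnt3_132_split L R n h1 (fun a ha => hlt a (by simp [ha]))
        (fun a ha => hlt a (by simp [ha]))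
      rw [h0] at hsplit
      have hLeq : (L.map (· - R.length)).map (· + R.length) = L := by
        rw [List.map_map]
        conv_rhs => rw [← List.map_id L]
        refine List.map_congr_left ?_
        intro a ha
        have := hLm a ha
        simp; omega
      have hLc : cnt3 r132 (L.map (· - R.length)) = 0 := by
        rw [← cnt3_map r132 r132 (· + R.length) (by simp [r132]), hLeq]; omega
      obtain ⟨tL, htL, htL'⟩ := ih L.length (by omega) _ hL hLc
      obtain ⟨tR, htR, htR'⟩ := ih R.length (by omega) _ hR (by omega)
      refine ⟨.node () tL tR, ?_, ?_⟩
      · simp only [numNodes]; omega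
      · simp only [toL]
        rw [htL', htR', htR, hLeq, htL, hlen]

theorem A_eq (n : ℕ) : A n = ((treesOfNumNodesEq n).filter (fun t => s123 t = 3)).card := by
  rw [A, ← Finset.card_image_of_injective _ permList_injective,
    ← Finset.card_image_of_injective ((treesOfNumNodesEq n).filter _) toL_injective]
  congr 1
  ext l
  simp only [Finset.mem_image, Finset.mem_filter, Finset.mem_univ, true_and,
    mem_treesOfNumNodesEq, count132_eq, count123_eq]
  constructor
  · rintro ⟨π, ⟨h1, h2⟩, rfl⟩
    obtain ⟨t, ht, ht'⟩ := exists_toL n _ (permList_perm π) h1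
    refine ⟨t, ⟨ht, ?_⟩, ht'⟩
    rw [← (toL_stats t).2.1, ht', h2]
  · rintro ⟨t, ⟨ht, h3⟩, rfl⟩
    obtain ⟨π, hπ⟩ := exists_permList (toL t) (ht ▸ toL_perm t)
    refine ⟨π, ⟨?_, ?_⟩, hπ⟩
    · rw [hπ, (toL_stats t).2.2]
    · rw [hπ, (toL_stats t).2.1, h3]

/-! ### Generating functions over trees -/

open PowerSeries in
noncomputable def gf (f : BinaryTree Unit → ℚ) : PowerSeries ℚ :=
  PowerSeries.mk fun n => ∑ t ∈ treesOfNumNodesEq n, f t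

theorem sum_trees_succ (f : BinaryTree Unit → ℚ) (n : ℕ) :
    ∑ t ∈ treesOfNumNodesEq (n + 1), f t =
      ∑ ij ∈ Finset.HasAntidiagonal.antidiagonal n, ∑ L ∈ treesOfNumNodesEq ij.1,
        ∑ R ∈ treesOfNumNodesEq ij.2, f (.node () L R) := by
  rw [treesOfNumNodesEq_succ, Finset.sum_biUnion]
  · refine Finset.sum_congr rfl fun ij _ => ?_
    rw [pairwiseNode, Finset.sum_map, Finset.sum_product]
    rfl
  · rintro ⟨i, j⟩ _ ⟨i', j'⟩ _ hne
    refine Finset.disjoint_left.2 ?_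
    intro t h1 h2
    simp only [pairwiseNode, Finset.mem_map, Finset.mem_product, mem_treesOfNumNodesEq,
      Function.Embedding.coeFn_mk] at h1 h2
    obtain ⟨⟨a, b⟩, ⟨ha, hb⟩, rfl⟩ := h1
    obtain ⟨⟨a', b'⟩, ⟨ha', hb'⟩, h⟩ := h2
    simp at h
    apply hne
    simp_all

theorem gf_rec {ι : Type*} (s : Finset ι) (f : BinaryTree Unit → ℚ) (u v : ι → BinaryTree Unit → ℚ)
    (h : ∀ L R, f (.node () L R) = ∑ i ∈ s, u i L * v i R) :
    gf f = PowerSeries.C (f .nil) + PowerSeries.X * ∑ i ∈ s, gf (u i) * gf (v i) := by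
  ext n
  rcases n with _ | n
  · simp [gf]
  · rw [map_add, PowerSeries.coeff_succ_X_mul, map_sum]
    simp only [gf, PowerSeries.coeff_mk, PowerSeries.coeff_mul, sum_trees_succ,
      PowerSeries.coeff_C, h]
    rw [Finset.sum_comm (s := s)]
    simp only [Nat.add_eq_zero_iff, one_ne_zero, and_false, if_false, zero_add]
    refine Finset.sum_congr rfl fun ij _ => ?_
    simp only [Finset.sum_mul_sum]
    rw [Finset.sum_comm (s := s)]
    refine Finset.sum_congr rfl fun L _ => ?_
    rw [Finset.sum_comm (s := s)]

/-- Indicator that a statistic takes a value. -/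
def ind (w : BinaryTree Unit → ℕ) (r : ℕ) (t : BinaryTree Unit) : ℚ := if w t = r then 1 else 0

theorem gf_ind_rec (w u v : BinaryTree Unit → ℕ)
    (h : ∀ L R, w (.node () L R) = u L + v R) (r : ℕ) :
    gf (ind w r) = PowerSeries.C (ind w r .nil) +
      PowerSeries.X * ∑ i ∈ Finset.range (r + 1), gf (ind u (r - i)) * gf (ind v i) := by
  apply gf_rec
  intro L R
  simp only [ind, h]
  by_cases hv : v R ≤ r
  · rw [Finset.sum_eq_single (v R)]
    · simp only [if_true, mul_one]
      congr 1
      apply propext; omega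
    · intro b _ hb; simp [hb.symm]
    · intro hb; simp at hb; omega
  · rw [if_neg (by omega), Finset.sum_eq_zero]
    intro i hi
    have : v R ≠ i := by simp at hi; omega
    simp [this]

def wK (t : BinaryTree Unit) : ℕ := s123 t + s12 t
def wM (t : BinaryTree Unit) : ℕ := s123 t + 2 * s12 t + t.numNodes
def wZ (t : BinaryTree Unit) : ℕ := s123 t + 3 * s12 t + 3 * t.numNodes

theorem gf_M0 : gf (ind wM 0) = 1 := by
  have h := gf_rec (∅ : Finset ℕ) (ind wM 0) (fun _ _ => 0) (fun _ _ => 0) (by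
    intro L R; simp [ind, wM, numNodes])
  rw [h]; simp [ind, wM, s12, s123, numNodes]

theorem gf_num0 : gf (ind numNodes 0) = 1 := by
  have h := gf_rec (∅ : Finset ℕ) (ind numNodes 0) (fun _ _ => 0) (fun _ _ => 0) (by
    intro L R; simp [ind, numNodes])
  rw [h]; simp [ind, numNodes]

theorem gf_M_succ (i : ℕ) (hi : i < 3) :
    gf (ind wM (i + 1)) = PowerSeries.X * gf (ind wM i) := by
  have h := gf_rec ({0} : Finset ℕ) (ind wM (i + 1)) (fun _ => ind numNodes 0)
    (fun _ => ind wM i) (by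
      intro L R
      rw [Finset.sum_singleton]
      have hw : wM (.node () L R) = wZ L + wM R + 1 := by
        simp only [wM, wZ, s12, s123, numNodes]; omega
      have hz : 3 * L.numNodes ≤ wZ L := by simp only [wZ]; omega
      have hz0 : L.numNodes = 0 → wZ L = 0 := by
        cases L with
        | nil => intro _; rfl
        | node _ a b => intro h; simp [numNodes] at h
      unfold ind
      rw [hw]
      by_cases hL : L.numNodes = 0
      · rw [hz0 hL, hL]; simp
      · rw [if_neg (by omega), if_neg hL, zero_mul])
  rw [h, Finset.sum_singleton, gf_num0]; simp [ind, wM, s12, s123, numNodes]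

theorem gf_K (r : ℕ) : gf (ind wK r) = PowerSeries.C (ind wK r .nil) +
    PowerSeries.X * ∑ i ∈ Finset.range (r + 1), gf (ind wM (r - i)) * gf (ind wK i) := by
  apply gf_ind_rec
  intro L R
  simp only [wK, wM, s12, s123]; omega

theorem gf_F (r : ℕ) : gf (ind s123 r) = PowerSeries.C (ind s123 r .nil) +
    PowerSeries.X * ∑ i ∈ Finset.range (r + 1), gf (ind wK (r - i)) * gf (ind s123 i) := by
  apply gf_ind_rec
  intro L R
  simp only [wK, s123]

theorem gf_A : PowerSeries.mk (fun n => (A n : ℚ)) = gf (ind s123 3) := by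
  ext n
  simp [gf, ind, A_eq]

theorem final_alg {R : Type*} [CommRing R] [IsDomain R] (X K0 K1 K2 K3 F0 F1 F2 F3 : R)
    (hX : 1 - X ≠ 0)
    (k0 : K0 = 1 + X * K0) (k1 : K1 = X * (X * K0 + K1))
    (k2 : K2 = X * (X ^ 2 * K0 + X * K1 + K2))
    (k3 : K3 = X * (X ^ 3 * K0 + X ^ 2 * K1 + X * K2 + K3))
    (f0 : F0 = 1 + X * (K0 * F0)) (f1 : F1 = X * (K1 * F0 + K0 * F1))
    (f2 : F2 = X * (K2 * F0 + K1 * F1 + K0 * F2))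
    (f3 : F3 = X * (K3 * F0 + K2 * F1 + K1 * F2 + K0 * F3)) :
    (1 - 2 * X) ^ 4 * F3 = X ^ 5 * (X - 1) ^ 2 := by
  have a0 : (1 - X) * K0 = 1 := by linear_combination k0
  have a1 : (1 - X) ^ 2 * K1 = X ^ 2 := by
    linear_combination (1 - X) * k1 + X ^ 2 * a0
  have a2 : (1 - X) ^ 3 * K2 = X ^ 4 + X ^ 3 * (1 - X) := by
    linear_combination (1 - X) ^ 2 * k2 + X ^ 3 * (1 - X) * a0 + X ^ 2 * a1
  have a3 : (1 - X) ^ 4 * K3 = X ^ 4 * (1 - X) ^ 2 + X ^ 5 * (1 - X)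
      + X ^ 2 * (X ^ 4 + X ^ 3 * (1 - X)) := by
    linear_combination (1 - X) ^ 3 * k3 + X ^ 4 * (1 - X) ^ 2 * a0 + X ^ 3 * (1 - X) * a1
      + X ^ 2 * a2
  have b0 : (1 - 2 * X) * F0 = 1 - X := by
    linear_combination (1 - X) * f0 + X * F0 * a0
  have b1 : (1 - 2 * X) ^ 2 * F1 = X ^ 3 := by
    apply mul_left_cancel₀ hX
    linear_combination (1 - 2 * X) * (1 - X) ^ 2 * f1 + (1 - 2 * X) * (X * F0 * a1)
      + (1 - 2 * X) * (X * (1 - X) * F1 * a0) + X ^ 3 * b0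
  have b2 : (1 - 2 * X) ^ 3 * F2 = X ^ 4 * (1 - X) := by
    apply mul_left_cancel₀ (pow_ne_zero 2 hX)
    linear_combination (1 - 2 * X) ^ 2 * ((1 - X) ^ 3 * f2 + X * F0 * a2 + X * (1 - X) * F1 * a1
      + X * (1 - X) ^ 2 * F2 * a0) + (1 - 2 * X) * X ^ 4 * b0 + X ^ 3 * (1 - X) * b1
  apply mul_left_cancel₀ (pow_ne_zero 3 hX)
  linear_combination (1 - 2 * X) ^ 3 * ((1 - X) ^ 4 * f3 + X * F0 * a3 + X * (1 - X) * F1 * a2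
      + X * (1 - X) ^ 2 * F2 * a1 + X * (1 - X) ^ 3 * F3 * a0)
      + (1 - 2 * X) ^ 2 * X ^ 5 * b0 + (1 - 2 * X) * X ^ 4 * (1 - X) * b1
      + X ^ 3 * (1 - X) ^ 2 * b2

theorem genfun_no132_3 :
    (1 - 2 * PowerSeries.X) ^ 4 * PowerSeries.mk (fun n => (A n : ℚ)) = PowerSeries.X ^ 5 * (PowerSeries.X - 1) ^ 2 := by
  have m0 := gf_M0
  have m1 := gf_M_succ 0 (by norm_num)
  have m2 := gf_M_succ 1 (by norm_num)
  have m3 := gf_M_succ 2 (by norm_num)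
  norm_num at m1 m2 m3
  rw [m0] at m1
  rw [m1] at m2
  rw [m2] at m3
  have k0 := gf_K 0
  have k1 := gf_K 1
  have k2 := gf_K 2
  have k3 := gf_K 3
  have f0 := gf_F 0
  have f1 := gf_F 1
  have f2 := gf_F 2
  have f3 := gf_F 3
  simp [Finset.sum_range_succ, m0, m1, m2, m3, ind, wK, s12, s123] at k0 k1 k2 k3 f0 f1 f2 f3
  rw [gf_A]
  refine final_alg PowerSeries.X (gf (ind wK 0)) (gf (ind wK 1)) (gf (ind wK 2)) (gf (ind wK 3))
    (gf (ind s123 0)) (gf (ind s123 1)) (gf (ind s123 2)) (gf (ind s123 3)) ?_ ?_ ?_ ?_ ?_ ?_ ?_ ?_ ?_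
  · intro h
    have := congrArg (PowerSeries.constantCoeff (R := ℚ)) h
    simp at this
  · linear_combination k0
  · linear_combination k1
  · linear_combination k2
  · linear_combination k3
  · linear_combination f0
  · linear_combination f1
  · linear_combination f2
  · linear_combination f3
end

section
/- Let B₂(n) denote the number of permutations of length n containing exactly one 132 pattern and exactly two 123 patterns. Then in ℚ[[z]], the generating function G₂(z) = ∑_{n≥0} B₂(n)·zⁿ satisfies (1 - 2z)⁴·G₂(z) = -z⁴·(z³ - 6z² + 4z - 1). -/
/-- The number of permutations of length n with exactly one 132 pattern and exactly 2 123 patterns. -/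
def B (n : ℕ) : ℕ :=
  (Finset.univ.filter (fun π : Equiv.Perm (Fin n) =>
    count132 π = 1 ∧ count123 π = 2)).card

/-- Prepend a first entry of value `p`, relabelling the other values. -/
def prep {n : ℕ} (p : Fin (n + 1)) (e : Equiv.Perm (Fin n)) : Equiv.Perm (Fin (n + 1)) :=
  (finSuccEquiv' 0).trans ((Equiv.optionCongr e).trans (finSuccEquiv' p).symm)

theorem prep_zero {n : ℕ} (p : Fin (n + 1)) (e : Equiv.Perm (Fin n)) : prep p e 0 = p := by
  simp [prep]

theorem prep_succ {n : ℕ} (p : Fin (n + 1)) (e : Equiv.Perm (Fin n)) (i : Fin n) :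
    prep p e i.succ = p.succAbove (e i) := by
  have h := finSuccEquiv'_succAbove (0 : Fin (n + 1)) i
  rw [Fin.succAbove_zero] at h
  simp [prep, h]

theorem prep_bij (n : ℕ) :
    Function.Bijective (fun x : Fin (n + 1) × Equiv.Perm (Fin n) => prep x.1 x.2) := by
  rw [Fintype.bijective_iff_injective_and_card]
  constructor
  · rintro ⟨p, e⟩ ⟨q, e'⟩ h
    simp only at h
    have h0 : p = q := by rw [← prep_zero p e, h, prep_zero]
    subst h0
    have : e = e' := by
      ext i
      have := congrArg (fun f => f i.succ) h
      simp only [prep_succ] at this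
      rw [Fin.succAbove_right_injective this]
    rw [this]
  · simp [Fintype.card_perm, Nat.factorial_succ]

/-- Ascending pairs among the top `m` values. -/
def U {n : ℕ} (e : Equiv.Perm (Fin n)) (m : ℕ) : ℕ :=
  ∑ i, ∑ j, if i < j ∧ e i < e j ∧ n ≤ (e i : ℕ) + m then 1 else 0

/-- Descending pairs among the top `m` values. -/
def D {n : ℕ} (e : Equiv.Perm (Fin n)) (m : ℕ) : ℕ :=
  ∑ i, ∑ j, if i < j ∧ e j < e i ∧ n ≤ (e j : ℕ) + m then 1 else 0

theorem count132_sum {n : ℕ} (π : Equiv.Perm (Fin n)) : count132 π =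
    ∑ i, ∑ j, ∑ k, if i < j ∧ j < k ∧ π i < π k ∧ π k < π j then 1 else 0 := by
  simp only [count132, Finset.card_filter, Fintype.sum_prod_type]

theorem count123_sum {n : ℕ} (π : Equiv.Perm (Fin n)) : count123 π =
    ∑ i, ∑ j, ∑ k, if i < j ∧ j < k ∧ π i < π j ∧ π j < π k then 1 else 0 := by
  simp only [count123, Finset.card_filter, Fintype.sum_prod_type]

theorem top_card {n : ℕ} (e : Equiv.Perm (Fin n)) (m : ℕ) (hm : m ≤ n) :
    (∑ i, if n ≤ (e i : ℕ) + m then 1 else 0) = m := by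
  rw [Equiv.sum_comp e (fun v : Fin n => if n ≤ (v : ℕ) + m then 1 else 0)]
  rw [← Equiv.sum_comp Fin.revPerm]
  rw [Finset.sum_congr rfl (g := fun v : Fin n => if (v : ℕ) < m then 1 else 0)
    (fun v _ => by
      have := v.2
      simp only [Fin.revPerm_apply, Fin.val_rev]
      congr 1
      apply propext
      omega)]
  rw [Fin.sum_univ_eq_sum_range (fun v => if v < m then 1 else 0) n, ← Finset.card_filter]
  have : Finset.filter (fun x => x < m) (Finset.range n) = Finset.range m := by
    ext x; simp; omega
  rw [this, Finset.card_range]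

theorem count123_prep {n : ℕ} (p : Fin (n + 1)) (e : Equiv.Perm (Fin n)) :
    count123 (prep p e) = count123 e + U e (n - p) := by
  rw [count123_sum, count123_sum, U, Fin.sum_univ_succ, add_comm]
  congr 1
  · simp only [Fin.sum_univ_succ, prep_zero, prep_succ, Fin.succAbove_lt_succAbove_iff,
      Fin.not_lt_zero, Fin.succ_lt_succ_iff, false_and, and_false, if_false,
      Finset.sum_const_zero, zero_add]
  · simp only [Fin.sum_univ_succ, prep_zero, prep_succ, Fin.succAbove_lt_succAbove_iff,
      Fin.not_lt_zero, Fin.succ_lt_succ_iff, Fin.succ_pos, Fin.lt_succAbove_iff_le_castSucc,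
      lt_self_iff_false, false_and, and_false, if_false, Finset.sum_const_zero, zero_add, true_and]
    refine Finset.sum_congr rfl fun i _ => Finset.sum_congr rfl fun j _ => ?_
    congr 1
    apply propext
    rw [Fin.le_def, Fin.val_castSucc]
    have := p.2
    constructor <;> rintro ⟨h1, h2, h3⟩ <;> refine ⟨h1, ?_, ?_⟩ <;> first | assumption | omega

theorem count132_prep {n : ℕ} (p : Fin (n + 1)) (e : Equiv.Perm (Fin n)) :
    count132 (prep p e) = count132 e + D e (n - p) := by
  rw [count132_sum, count132_sum, D, Fin.sum_univ_succ, add_comm]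
  congr 1
  · simp only [Fin.sum_univ_succ, prep_zero, prep_succ, Fin.succAbove_lt_succAbove_iff,
      Fin.not_lt_zero, Fin.succ_lt_succ_iff, false_and, and_false, if_false,
      Finset.sum_const_zero, zero_add]
  · simp only [Fin.sum_univ_succ, prep_zero, prep_succ, Fin.succAbove_lt_succAbove_iff,
      Fin.not_lt_zero, Fin.succ_lt_succ_iff, Fin.succ_pos, Fin.lt_succAbove_iff_le_castSucc,
      lt_self_iff_false, false_and, and_false, if_false, Finset.sum_const_zero, zero_add, true_and]
    refine Finset.sum_congr rfl fun i _ => Finset.sum_congr rfl fun j _ => ?_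
    congr 1
    apply propext
    rw [Fin.le_def, Fin.val_castSucc]
    have := p.2
    constructor <;> rintro ⟨h1, h2, h3⟩ <;> refine ⟨h1, ?_, ?_⟩ <;> first | assumption | omega

theorem U_prep {n : ℕ} (p : Fin (n + 1)) (e : Equiv.Perm (Fin n)) (m : ℕ) :
    U (prep p e) (m + 1) = if n - p < m + 1 then U e m + (n - p) else U e (m + 1) := by
  have hp := p.2
  have key : ∀ x : Fin n, ((p.succAbove x : Fin (n + 1)) : ℕ) =
      if (x : ℕ) < p then (x : ℕ) else x + 1 := by
    intro x
    rw [Fin.succAbove]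
    simp only [Fin.lt_def, Fin.val_castSucc]
    split_ifs <;> simp
  rw [U, Fin.sum_univ_succ, add_comm]
  simp only [Fin.sum_univ_succ, prep_zero, prep_succ, Fin.succAbove_lt_succAbove_iff,
      Fin.not_lt_zero, Fin.succ_lt_succ_iff, Fin.succ_pos, Fin.lt_succAbove_iff_le_castSucc,
      lt_self_iff_false, false_and, if_false, zero_add, true_and]
  split_ifs with h
  · congr 1
    · rw [U]
      refine Finset.sum_congr rfl fun i _ => Finset.sum_congr rfl fun j _ => ?_
      congr 1
      apply propext
      rw [key]
      refine and_congr_right fun _ => and_congr_right fun _ => ?_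
      split_ifs <;> omega
    · rw [← top_card e (n - p) (by omega)]
      refine Finset.sum_congr rfl fun i _ => ?_
      congr 1
      apply propext
      rw [Fin.le_def, Fin.val_castSucc]
      omega
  · rw [U]
    have : (∑ x : Fin n, if p ≤ (e x).castSucc ∧ n + 1 ≤ (p : ℕ) + (m + 1) then 1 else 0) = 0 := by
      apply Finset.sum_eq_zero
      intro x _
      rw [if_neg]
      omega
    rw [this, add_zero]
    refine Finset.sum_congr rfl fun i _ => Finset.sum_congr rfl fun j _ => ?_
    congr 1
    apply propext
    rw [key]
    refine and_congr_right fun _ => and_congr_right fun _ => ?_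
    split_ifs <;> omega

theorem UD {n : ℕ} (e : Equiv.Perm (Fin n)) (m : ℕ) (hm : m ≤ n) :
    2 * (U e m + D e m) + m = m * m := by
  have h1 := top_card e m hm
  have hU : U e m + D e m = ∑ i, ∑ j,
      if i < j ∧ n ≤ (e i : ℕ) + m ∧ n ≤ (e j : ℕ) + m then 1 else 0 := by
    simp only [U, D, ← Finset.sum_add_distrib]
    refine Finset.sum_congr rfl fun i _ => Finset.sum_congr rfl fun j _ => ?_
    by_cases hij : i < j
    · have hne : (e i : ℕ) ≠ e j := fun h => hij.ne (e.injective (Fin.ext h))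
      simp only [hij, true_and, Fin.lt_def]
      split_ifs <;> omega
    · simp [hij]
  have hU' : U e m + D e m = ∑ i, ∑ j,
      if j < i ∧ n ≤ (e i : ℕ) + m ∧ n ≤ (e j : ℕ) + m then 1 else 0 := by
    rw [hU, Finset.sum_comm]
    refine Finset.sum_congr rfl fun i _ => Finset.sum_congr rfl fun j _ => ?_
    congr 1
    apply propext
    tauto
  have hd : m = ∑ i, ∑ j,
      if i = j ∧ n ≤ (e i : ℕ) + m ∧ n ≤ (e j : ℕ) + m then 1 else 0 := by
    conv_lhs => rw [← h1]
    refine Finset.sum_congr rfl fun i _ => ?_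
    rw [Finset.sum_eq_single i]
    · simp
    · intro b _ hb
      simp [hb.symm]
    · simp
  have hs : m * m = ∑ i, ∑ j,
      if n ≤ (e i : ℕ) + m ∧ n ≤ (e j : ℕ) + m then 1 else 0 := by
    conv_lhs => rw [← h1]
    rw [Finset.sum_mul_sum]
    refine Finset.sum_congr rfl fun i _ => Finset.sum_congr rfl fun j _ => ?_
    clear hd hU hU' h1
    by_cases ha : n ≤ (e i : ℕ) + m <;> by_cases hb : n ≤ (e j : ℕ) + m <;> simp [ha, hb]
  have hall : (∑ i, ∑ j, if n ≤ (e i : ℕ) + m ∧ n ≤ (e j : ℕ) + m then 1 else 0) =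
      (∑ i, ∑ j, if i < j ∧ n ≤ (e i : ℕ) + m ∧ n ≤ (e j : ℕ) + m then 1 else 0) +
      (∑ i, ∑ j, if j < i ∧ n ≤ (e i : ℕ) + m ∧ n ≤ (e j : ℕ) + m then 1 else 0) +
      (∑ i, ∑ j, if i = j ∧ n ≤ (e i : ℕ) + m ∧ n ≤ (e j : ℕ) + m then 1 else 0) := by
    simp only [← Finset.sum_add_distrib]
    refine Finset.sum_congr rfl fun i _ => Finset.sum_congr rfl fun j _ => ?_
    rcases lt_trichotomy i j with h | h | h
    · simp [h, h.not_gt, h.ne]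
    · simp [h]
    · simp [h, h.not_gt, h.ne']
  rw [← hs, ← hU, ← hU', ← hd] at hall
  omega

/-- Weighted sum over permutations of a function of the state. -/
def F (n : ℕ) (f : ℕ → ℕ → ℕ → ℕ → ℕ) : ℕ :=
  ∑ π : Equiv.Perm (Fin n), f (count132 π) (count123 π) (U π 2) (U π 3)

/-- Transfer operator. -/
def L (f : ℕ → ℕ → ℕ → ℕ → ℕ) (a c u t : ℕ) : ℕ :=
  if a ≤ 1 ∧ c ≤ 2 then
    f a c 0 u + f a c 1 (u + 1) + f (a + (1 - u)) (c + u) u (u + 2) +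
      f (a + (3 - t)) (c + t) u t
  else 0

theorem U_one {n : ℕ} (e : Equiv.Perm (Fin n)) (hn : 1 ≤ n) : U e 1 = 0 := by
  have := UD e 1 hn
  omega

theorem U_zero {n : ℕ} (e : Equiv.Perm (Fin n)) : U e 0 = 0 := by
  have := UD e 0 (by omega)
  omega

theorem F_succ (n : ℕ) (hn : 3 ≤ n) (f : ℕ → ℕ → ℕ → ℕ → ℕ)
    (hf : ∀ a c u t, 2 ≤ a ∨ 3 ≤ c → f a c u t = 0) : F (n + 1) f = F n (L f) := by
  rw [F, ← (prep_bij n).sum_comp, Fintype.sum_prod_type, Finset.sum_comm, F]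
  refine Finset.sum_congr rfl fun e _ => ?_
  simp only [count123_prep, count132_prep, U_prep]
  rw [← Equiv.sum_comp Fin.revPerm]
  have hr : ∀ k : Fin (n + 1), n - ((Fin.revPerm k : Fin (n + 1)) : ℕ) = k := by
    intro k
    have := k.2
    simp only [Fin.revPerm_apply, Fin.val_rev]
    omega
  simp only [hr]
  rw [Fin.sum_univ_eq_sum_range (fun k => f (count132 e + D e k) (count123 e + U e k)
    (if k < 1 + 1 then U e 1 + k else U e (1 + 1))
    (if k < 2 + 1 then U e 2 + k else U e (2 + 1))) (n + 1)]
  rw [← Finset.sum_subset (s₁ := Finset.range 4)]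
  · have h0 := UD e 0 (by omega)
    have h1 := UD e 1 (by omega)
    have h2 := UD e 2 (by omega)
    have h3 := UD e 3 (by omega)
    have e0 : U e 0 = 0 := by omega
    have e1 : U e 1 = 0 := by omega
    have d0 : D e 0 = 0 := by omega
    have d1 : D e 1 = 0 := by omega
    have d2 : D e 2 = 1 - U e 2 := by omega
    have d3 : D e 3 = 3 - U e 3 := by omega
    simp only [Finset.sum_range_succ, Finset.sum_range_zero, L]
    by_cases h : count132 e ≤ 1 ∧ count123 e ≤ 2
    · rw [if_pos h]
      simp [e0, e1, d0, d1, d2, d3]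
    · have hh : 2 ≤ count132 e ∨ 3 ≤ count123 e := by omega
      rw [if_neg h, hf _ _ _ _ (by omega), hf _ _ _ _ (by omega), hf _ _ _ _ (by omega),
        hf _ _ _ _ (by omega)]
  · intro x
    simp
    omega
  · intro k hk hk'
    simp only [Finset.mem_range] at hk hk'
    have := UD e k (by omega)
    apply hf
    have : 4 * k ≤ k * k := Nat.mul_le_mul_right _ (by omega)
    omega

theorem L_van (f : ℕ → ℕ → ℕ → ℕ → ℕ) (a c u t : ℕ) (h : 2 ≤ a ∨ 3 ≤ c) : L f a c u t = 0 := by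
  rw [L, if_neg]
  omega

/-- Target indicator. -/
def f0 (a c _u _t : ℕ) : ℕ := if a = 1 ∧ c = 2 then 1 else 0

theorem iter_van (k : ℕ) : ∀ a c u t, 2 ≤ a ∨ 3 ≤ c → (L^[k] f0) a c u t = 0 := by
  cases k with
  | zero => intro a c u t h; simp only [Function.iterate_zero, id, f0]; rw [if_neg]; omega
  | succ k => intro a c u t h; rw [Function.iterate_succ_apply']; exact L_van _ _ _ _ _ h

theorem F_iter (n : ℕ) (hn : 3 ≤ n) (k j : ℕ) : F (n + k) (L^[j] f0) = F n (L^[j + k] f0) := by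
  induction k generalizing j with
  | zero => rfl
  | succ k ih =>
    rw [← add_assoc, F_succ _ (by omega) _ (iter_van j), ← Function.iterate_succ_apply' L,
      ih, Nat.succ_eq_add_one]
    congr 2
    omega

theorem B_eq (n : ℕ) : B n = F n f0 := by
  simp only [B, F, f0, Finset.card_filter]

theorem B_add (n : ℕ) (hn : 3 ≤ n) (k : ℕ) : B (n + k) = F n (L^[k] f0) := by
  rw [B_eq, ← Function.iterate_zero_apply L f0, F_iter n hn, zero_add]
  simp

theorem L_rec : ∀ a < 2, ∀ c < 3, ∀ u < 2, ∀ t < 4,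
    (L^[7] f0) a c u t + 24 * (L^[5] f0) a c u t + 16 * (L^[3] f0) a c u t =
    8 * (L^[6] f0) a c u t + 32 * (L^[4] f0) a c u t := by
  decide +kernel

theorem B_rec (n : ℕ) : B (n + 10) + 24 * B (n + 8) + 16 * B (n + 6) =
    8 * B (n + 9) + 32 * B (n + 7) := by
  rw [show n + 10 = n + 3 + 7 by ring, show n + 9 = n + 3 + 6 by ring,
    show n + 8 = n + 3 + 5 by ring, show n + 7 = n + 3 + 4 by ring,
    show n + 6 = n + 3 + 3 by ring]
  simp only [B_add (n + 3) (by omega), F, Finset.mul_sum, ← Finset.sum_add_distrib]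
  refine Finset.sum_congr rfl fun e _ => ?_
  have h2 := UD e 2 (by omega)
  have h3 := UD e 3 (by omega)
  by_cases h : 2 ≤ count132 e ∨ 3 ≤ count123 e
  · simp only [iter_van _ _ _ _ _ h, mul_zero, add_zero]
  · exact L_rec _ (by omega) _ (by omega) _ (by omega) _ (by omega)

theorem B_small : B 0 = 0 ∧ B 1 = 0 ∧ B 2 = 0 ∧ B 3 = 0 := by
  decide +kernel

theorem B_small' : B 4 = 1 ∧ B 5 = 4 ∧ B 6 = 14 ∧ B 7 = 47 ∧ B 8 = 152 ∧ B 9 = 472 := by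
  refine ⟨(B_add 3 le_rfl 1).trans ?_, (B_add 3 le_rfl 2).trans ?_, (B_add 3 le_rfl 3).trans ?_,
    (B_add 3 le_rfl 4).trans ?_, (B_add 3 le_rfl 5).trans ?_, (B_add 3 le_rfl 6).trans ?_⟩ <;>
  decide +kernel

theorem genfun_one132_2 :
    (1 - 2 * PowerSeries.X) ^ 4 * PowerSeries.mk (fun n => (B n : ℚ)) = -(PowerSeries.X ^ 4) * (PowerSeries.X ^ 3 - 6 * PowerSeries.X ^ 2 + 4 * PowerSeries.X - 1) := by
  obtain ⟨b0, b1, b2, b3⟩ := B_small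
  obtain ⟨b4, b5, b6, b7, b8, b9⟩ := B_small'
  have e1 : ((1 - 2 * PowerSeries.X) ^ 4 : PowerSeries ℚ) =
      1 - PowerSeries.C 8 * PowerSeries.X ^ 1 + PowerSeries.C 24 * PowerSeries.X ^ 2
      - PowerSeries.C 32 * PowerSeries.X ^ 3 + PowerSeries.C 16 * PowerSeries.X ^ 4 := by
    simp only [map_ofNat]
    ring
  have e2 : (-(PowerSeries.X ^ 4) * (PowerSeries.X ^ 3 - 6 * PowerSeries.X ^ 2 + 4 * PowerSeries.X - 1) : PowerSeries ℚ) = PowerSeries.X ^ 4 - PowerSeries.C 4 * PowerSeries.X ^ 5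
      + PowerSeries.C 6 * PowerSeries.X ^ 6 - PowerSeries.X ^ 7 := by
    simp only [map_ofNat]
    ring
  rw [e1, e2]
  ext n
  simp only [add_mul, sub_mul, one_mul, mul_assoc, map_add, map_sub, PowerSeries.coeff_C_mul,
    PowerSeries.coeff_X_pow_mul', PowerSeries.coeff_mk, PowerSeries.coeff_X_pow]
  by_cases hn : n < 10
  · interval_cases n <;> norm_num [b0, b1, b2, b3, b4, b5, b6, b7, b8, b9]
  · obtain ⟨m, rfl⟩ : ∃ m, n = m + 10 := ⟨n - 10, by omega⟩
    have h := congrArg (Nat.cast : ℕ → ℚ) (B_rec m)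
    push_cast at h
    rw [if_pos (by omega), if_pos (by omega), if_pos (by omega), if_pos (by omega),
      if_neg (by omega), if_neg (by omega), if_neg (by omega), if_neg (by omega)]
    simp only [show m + 10 - 1 = m + 9 by omega, show m + 10 - 2 = m + 8 by omega,
      show m + 10 - 3 = m + 7 by omega, show m + 10 - 4 = m + 6 by omega]
    linarith
end
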